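/- arXiv:1706.04628 — 2 statements merged into one kernel-verified Lean document; each statement's English description precedes it below -/
import Mathlib

section
/- Let X_1, ..., X_L be a completely general (not necessarily independent) sequence of real-valued random variables. Suppose there exist constants γ > 1, ν ≥ γ, and C > 0 such that for all λ > 0 and all integers 1 ≤ i ≤ j ≤ L, P(|∑_{k=i}^j X_k| ≥ λ) ≤ (C(j − i + 1))^γ λ^{−ν}. Then for all λ > 0, P(max_{1 ≤ i ≤ L} |∑_{k=1}^i X_k| ≥ λ) ≤ (6(ν+1)/(γ−1))^{ν+1} (C L)^γ λ^{−ν}. -/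
open MeasureTheory

lemma chain_bound (S : ℕ → ℝ) (t : ℕ → ℝ) (ht : ∀ k, 0 ≤ t k) (L i : ℕ) (hi : i ≤ L) (n : ℕ)
    (h : ∀ k < n, ∀ a < L / 2 ^ k, |S ((a + 1) * 2 ^ k) - S (a * 2 ^ k)| ≤ t k) :
    |S i - S (i / 2 ^ n * 2 ^ n)| ≤ ∑ k ∈ Finset.range n, t k := by
  induction n with
  | zero => simp
  | succ n ih =>
    have h1 := ih (fun k hk => h k (by omega))
    rw [Finset.sum_range_succ]
    have h2 : |S (i / 2 ^ n * 2 ^ n) - S (i / 2 ^ (n + 1) * 2 ^ (n + 1))| ≤ t n := by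
      have e : i / 2 ^ (n + 1) = i / 2 ^ n / 2 := by rw [pow_succ, Nat.div_div_eq_div_mul]
      have hle : i / 2 ^ n ≤ L / 2 ^ n := Nat.div_le_div_right hi
      have e2 : i / 2 ^ (n + 1) * 2 ^ (n + 1) = (i / 2 ^ n / 2 * 2) * 2 ^ n := by
        rw [e, pow_succ]; ring
      rw [e2]
      generalize i / 2 ^ n = b at *
      rcases Nat.even_or_odd' b with ⟨c, rfl | rfl⟩
      · have : 2 * c / 2 * 2 = 2 * c := by omega
        rw [this]; simpa using ht n
      · have : (2 * c + 1) / 2 * 2 = 2 * c := by omega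
        rw [this]
        exact h n (by omega) (2 * c) (by omega)
    calc _ ≤ _ := abs_sub_le _ (S (i / 2 ^ n * 2 ^ n)) _
      _ ≤ _ := add_le_add h1 h2

lemma level_bound (γ ν C lam x N Q A L s : ℝ) (hγ : 1 < γ) (hν : γ ≤ ν) (hC : 0 < C)
    (hl : 0 < lam) (hx : x = (γ - 1) / (ν + 1)) (hQ : 0 < Q) (hA : 0 < A) (hL : 0 < L)
    (hs : 0 < s) (hN : N ≤ L / Q) (hAQ : A * Q ≤ L) :
    N * ((C * Q) ^ γ * (lam * s * A ^ (-x)) ^ (-ν))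
      ≤ (C * L) ^ γ * lam ^ (-ν) * s ^ (-ν) * A ^ (-x) := by
  have hR : 0 < A ^ (-x) := by positivity
  have e1 : (lam * s * A ^ (-x)) ^ (-ν) = lam ^ (-ν) * s ^ (-ν) * (A ^ (-x)) ^ (-ν) := by
    rw [Real.mul_rpow (by positivity) hR.le, Real.mul_rpow hl.le hs.le]
  have hx' : x * ν = γ - 1 - x := by
    rw [hx]; field_simp [show ν + 1 ≠ 0 by linarith]; ring
  have e2 : (A ^ (-x)) ^ (-ν) = A ^ (γ - 1) * A ^ (-x) := by
    rw [← Real.rpow_mul hA.le, ← Real.rpow_add hA]; congr 1; linarith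
  have e3 : Q ^ γ = Q * Q ^ (γ - 1) := by
    rw [← Real.rpow_one_add' hQ.le (by linarith)]; congr 1; ring
  have e4 : L ^ γ = L * L ^ (γ - 1) := by
    rw [← Real.rpow_one_add' hL.le (by linarith)]; congr 1; ring
  have h5 : A ^ (γ - 1) * Q ^ (γ - 1) ≤ L ^ (γ - 1) := by
    rw [← Real.mul_rpow hA.le hQ.le]
    exact Real.rpow_le_rpow (by positivity) hAQ (by linarith)
  have h6 : N * Q ≤ L := by rwa [le_div_iff₀ hQ] at hN
  have h7 : (N * Q) * (A ^ (γ - 1) * Q ^ (γ - 1)) ≤ L * L ^ (γ - 1) :=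
    mul_le_mul h6 h5 (by positivity) hL.le
  rw [e1, e2, Real.mul_rpow hC.le hQ.le, Real.mul_rpow hC.le hL.le, e3, e4]
  have h8 : 0 ≤ C ^ γ * lam ^ (-ν) * s ^ (-ν) * A ^ (-x) := by positivity
  have := mul_le_mul_of_nonneg_left h7 h8
  linarith

/-- Maximal inequality (Longnecker–Serfling / Billingsley type): bounds on the tails of
absolute values of partial-sum blocks imply a bound on the tail of the maximum of the
partial sums, for a completely general (not necessarily independent) sequence. -/
theorem maximal_inequality
    {Ω : Type*} [MeasurableSpace Ω] (μ : Measure Ω) [IsProbabilityMeasure μ]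
    (L : ℕ) (X : ℕ → Ω → ℝ) (γ ν C : ℝ)
    (hγ : 1 < γ) (hν : γ ≤ ν) (hC : 0 < C)
    (hyp : ∀ i j : ℕ, 1 ≤ i → i ≤ j → j ≤ L → ∀ lam : ℝ, 0 < lam →
      (μ {ω | lam ≤ |∑ k ∈ Finset.Icc i j, X k ω|}).toReal
        ≤ (C * ((j : ℝ) - (i : ℝ) + 1)) ^ γ * lam ^ (-ν)) :
    ∀ lam : ℝ, 0 < lam →
      (μ {ω | ∃ i : ℕ, 1 ≤ i ∧ i ≤ L ∧ lam ≤ |∑ k ∈ Finset.Icc 1 i, X k ω|}).toReal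
        ≤ (6 * (ν + 1) / (γ - 1)) ^ (ν + 1) * (C * (L : ℝ)) ^ γ * lam ^ (-ν) := by
  intro lam hl
  have hg1 : 0 < γ - 1 := by linarith
  have hn1 : 0 < ν + 1 := by linarith
  rcases Nat.eq_zero_or_pos L with rfl | hL
  · have : {ω | ∃ i : ℕ, 1 ≤ i ∧ i ≤ 0 ∧ lam ≤ |∑ k ∈ Finset.Icc 1 i, X k ω|} = ∅ := by
      ext ω; simp
    rw [this]
    simp only [measure_empty, ENNReal.toReal_zero]
    positivity
  have hLr : (0 : ℝ) < L := by exact_mod_cast hL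
  set m := Nat.log 2 L with hm
  have hmL : 2 ^ m ≤ L := Nat.pow_log_le_self 2 hL.ne'
  have hLm : L < 2 ^ (m + 1) := Nat.lt_pow_succ_log_self (by norm_num) L
  obtain ⟨x, hx⟩ : ∃ x : ℝ, x = (γ - 1) / (ν + 1) := ⟨_, rfl⟩
  have hx0 : 0 < x := by rw [hx]; positivity
  have hx1 : x ≤ 1 := by rw [hx, div_le_one hn1]; linarith
  obtain ⟨r, hr⟩ : ∃ r : ℝ, r = (2 : ℝ) ^ (-x) := ⟨_, rfl⟩
  have hr0 : 0 < r := by rw [hr]; positivity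
  have hrx : x / 2 ≤ 1 - r := by
    have h := rpow_one_add_le_one_add_mul_self (s := -(1/2)) (by norm_num) hx0.le hx1
    have : r = (1 + -(1/2) : ℝ) ^ x := by
      rw [hr, Real.rpow_neg (by norm_num), ← Real.inv_rpow (by norm_num)]; norm_num
    rw [← this] at h
    linarith
  have hs0 : 0 < 1 - r := by linarith
  have hrl : ∀ l : ℕ, ((2 : ℝ) ^ l) ^ (-x) = r ^ l := by
    intro l
    rw [hr, ← Real.rpow_natCast, ← Real.rpow_natCast, ← Real.rpow_mul (by norm_num),
      ← Real.rpow_mul (by norm_num), mul_comm]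
  let t : ℕ → ℝ := fun k => lam * (1 - r) * r ^ (m - k)
  have ht : ∀ k, 0 < t k := fun k => by positivity
  let S : Ω → ℕ → ℝ := fun ω n => ∑ k ∈ Finset.Icc 1 n, X k ω
  have hS : ∀ ω a b, a ≤ b → S ω b - S ω a = ∑ k ∈ Finset.Icc (a + 1) b, X k ω := by
    intro ω a b hab
    have e : ∀ a b : ℕ, Finset.Icc (a + 1) b = Finset.Ioc a b := fun a b => by
      ext; simp
    have e0 := e 0
    simp only [zero_add] at e0
    simp only [S, e, e0]
    rw [← Finset.sum_Ioc_consecutive _ (Nat.zero_le a) hab]; ring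
  let E : ℕ → ℕ → Set Ω := fun k a => {ω | t k ≤ |S ω ((a + 1) * 2 ^ k) - S ω (a * 2 ^ k)|}
  have hgeo : ∑ k ∈ Finset.range (m + 1), r ^ (m - k) = (1 - r ^ (m + 1)) / (1 - r) := by
    have := Finset.sum_range_reflect (fun k => r ^ k) (m + 1)
    simp only [Nat.add_sub_cancel] at this
    rw [this, eq_div_iff hs0.ne', ← geom_sum_mul_neg]
  have hsub : {ω | ∃ i : ℕ, 1 ≤ i ∧ i ≤ L ∧ lam ≤ |∑ k ∈ Finset.Icc 1 i, X k ω|} ⊆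
      ⋃ k ∈ Finset.range (m + 1), ⋃ a ∈ Finset.range (L / 2 ^ k), E k a := by
    rintro ω ⟨i, -, hi, hlam⟩
    by_contra hcon
    simp only [Set.mem_iUnion, not_exists, Finset.mem_range, E, Set.mem_ofPred_eq, not_le] at hcon
    have h := chain_bound (S ω) t (fun k => (ht k).le) L i hi (m + 1)
      (fun k hk a ha => (hcon k hk a ha).le)
    rw [Nat.div_eq_of_lt (by omega : i < 2 ^ (m + 1))] at h
    simp only [t] at h
    rw [← Finset.mul_sum, hgeo] at h
    have h0 : S ω (0 * 2 ^ (m + 1)) = 0 := by simp [S]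
    rw [h0, sub_zero] at h
    have h2 : lam * (1 - r) * ((1 - r ^ (m + 1)) / (1 - r)) = lam * (1 - r ^ (m + 1)) := by
      field_simp
    rw [h2] at h
    have h3 : lam ≤ lam * (1 - r ^ (m + 1)) := hlam.trans h
    have : 0 < lam * r ^ (m + 1) := by positivity
    linarith
  have hE : ∀ k a, a < L / 2 ^ k → μ.real (E k a) ≤ (C * 2 ^ k) ^ γ * (t k) ^ (-ν) := by
    intro k a ha
    have hle : (a + 1) * 2 ^ k ≤ L :=
      (Nat.mul_le_mul_right _ ha).trans (Nat.div_mul_le_self _ _)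
    have hp : 0 < 2 ^ k := by positivity
    have h := hyp (a * 2 ^ k + 1) ((a + 1) * 2 ^ k) (by omega) (by rw [add_mul]; omega) hle
      (t k) (ht k)
    have e : (((a + 1) * 2 ^ k : ℕ) : ℝ) - ((a * 2 ^ k + 1 : ℕ) : ℝ) + 1 = 2 ^ k := by
      push_cast; ring
    rw [e] at h
    have e2 : E k a = {ω | t k ≤ |∑ j ∈ Finset.Icc (a * 2 ^ k + 1) ((a + 1) * 2 ^ k), X j ω|} := by
      ext ω
      simp only [E, Set.mem_ofPred_eq]
      rw [hS ω _ _ (by rw [add_mul]; omega)]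
    rw [e2]; exact h
  have hlev : ∀ k ∈ Finset.range (m + 1), μ.real (⋃ a ∈ Finset.range (L / 2 ^ k), E k a) ≤
      (C * L) ^ γ * lam ^ (-ν) * (1 - r) ^ (-ν) * r ^ (m - k) := by
    intro k hk
    have hk' : k ≤ m := by simpa [Nat.lt_succ_iff] using hk
    refine (measureReal_biUnion_finset_le _ _).trans ?_
    refine (Finset.sum_le_sum fun a ha => hE k a (by simpa using ha)).trans ?_
    rw [Finset.sum_const, Finset.card_range, nsmul_eq_mul]
    have := level_bound γ ν C lam x ((L / 2 ^ k : ℕ) : ℝ) (2 ^ k) (2 ^ (m - k)) L (1 - r) hγ hν hC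
      hl hx (by positivity) (by positivity) hLr hs0
      (by have := @Nat.cast_div_le ℝ _ _ _ L (2 ^ k); push_cast at this; exact this)
      (by rw [← pow_add, Nat.sub_add_cancel hk']; exact_mod_cast hmL)
    rw [hrl] at this
    exact this
  have hfin : μ.real {ω | ∃ i : ℕ, 1 ≤ i ∧ i ≤ L ∧ lam ≤ |∑ k ∈ Finset.Icc 1 i, X k ω|} ≤
      (C * L) ^ γ * lam ^ (-ν) * (1 - r) ^ (-ν) * ((1 - r ^ (m + 1)) / (1 - r)) := by
    refine (measureReal_mono hsub (measure_ne_top _ _)).trans ((measureReal_biUnion_finset_le _ _).trans ?_)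
    refine (Finset.sum_le_sum hlev).trans ?_
    rw [← Finset.mul_sum, hgeo]
  refine hfin.trans ?_
  have h1 : (1 - r ^ (m + 1)) / (1 - r) ≤ (1 - r)⁻¹ := by
    rw [inv_eq_one_div]
    have : 0 < r ^ (m + 1) := by positivity
    gcongr; linarith
  have h2 : (1 - r) ^ (-ν) * (1 - r)⁻¹ = ((1 - r)⁻¹) ^ (ν + 1) := by
    rw [Real.inv_rpow hs0.le, ← Real.rpow_neg hs0.le, ← Real.rpow_neg_one, ← Real.rpow_add hs0]
    congr 1; ring
  have h3 : (1 - r)⁻¹ ≤ 6 * (ν + 1) / (γ - 1) := by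
    have : (1 - r)⁻¹ ≤ (x / 2)⁻¹ := inv_anti₀ (by positivity) hrx
    refine this.trans ?_
    have e : (x / 2)⁻¹ = 2 * (ν + 1) / (γ - 1) := by rw [hx]; field_simp
    rw [e]; gcongr; norm_num
  have h4 : ((1 - r)⁻¹) ^ (ν + 1) ≤ (6 * (ν + 1) / (γ - 1)) ^ (ν + 1) :=
    Real.rpow_le_rpow (by positivity) h3 hn1.le
  have hK : 0 ≤ (C * L) ^ γ * lam ^ (-ν) := by positivity
  calc _ ≤ (C * L) ^ γ * lam ^ (-ν) * (1 - r) ^ (-ν) * (1 - r)⁻¹ := by gcongr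
    _ = (C * L) ^ γ * lam ^ (-ν) * ((1 - r)⁻¹) ^ (ν + 1) := by rw [mul_assoc, h2]
    _ ≤ (C * L) ^ γ * lam ^ (-ν) * (6 * (ν + 1) / (γ - 1)) ^ (ν + 1) := by gcongr
    _ = _ := by ring
end

section
/- Let {φ(k), k ≥ 0} be a discrete-time real-valued stochastic process with stationary increments and φ(0) = 0. Suppose there exist strictly positive finite constants H_3, s_3, r_3 with r_3 > s_3 ≥ 1 such that for all integers m ≥ 1 and all λ > 0, P(max_{j ∈ {0,...,m}} φ(j) ≥ λ) ≤ H_3 m^{s_3} λ^{−r_3}. Then for every drift parameter ν > 0 and all λ > 0, P(sup_{k ≥ 0}(φ(k) − νk) ≥ λ) ≤ 16 H_3 4^{r_3} (1 + 1/(r_3 − s_3)) ν^{−s_3} λ^{−(r_3 − s_3)}. -/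
open MeasureTheory ProbabilityTheory
open scoped ENNReal

/-- Tail bound for the all-time supremum of a discrete-time stochastic process with
stationary increments and negative drift, given a polynomial tail bound for the running
maximum of the process. -/
theorem tail_bound_discrete
    {Ω : Type*} [MeasurableSpace Ω] (μ : Measure Ω) [IsProbabilityMeasure μ]
    (φ : ℕ → Ω → ℝ)
    (hφmeas : ∀ k, Measurable (φ k))
    (hφ0 : ∀ ω, φ 0 ω = 0)
    -- stationary increments: for each k₀ ≥ 0, the shifted-and-recentered process has
    -- the same law (as a random sequence) as the original process
    (hstat : ∀ k₀ : ℕ,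
      μ.map (fun ω => fun k : ℕ => φ (k + k₀) ω - φ k₀ ω)
        = μ.map (fun ω => fun k : ℕ => φ k ω))
    (H₃ s₃ r₃ : ℝ)
    (hH₃ : 0 < H₃) (hs₃ : 1 ≤ s₃) (hr₃ : s₃ < r₃)
    (hyp : ∀ m : ℕ, 1 ≤ m → ∀ lam : ℝ, 0 < lam →
      (μ {ω | ∃ j : ℕ, j ≤ m ∧ lam ≤ φ j ω}).toReal
        ≤ H₃ * (m : ℝ) ^ s₃ * lam ^ (-r₃)) :
    ∀ ν : ℝ, 0 < ν → ∀ lam : ℝ, 0 < lam →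
      (μ {ω | (lam : EReal) ≤ ⨆ k : ℕ, ((φ k ω - ν * (k : ℝ) : ℝ) : EReal)}).toReal
        ≤ 16 * H₃ * 4 ^ r₃ * (1 + 1 / (r₃ - s₃)) * ν ^ (-s₃) * lam ^ (-(r₃ - s₃)) := by
  intro ν hν lam hlam
  obtain ⟨L, hL⟩ : ∃ L, L = lam / 2 := ⟨_, rfl⟩
  have hL0 : 0 < L := by rw [hL]; positivity
  have hd : 0 < r₃ - s₃ := by linarith
  obtain ⟨q, hq⟩ : ∃ q : ℝ, q = 2 ^ (s₃ - r₃) := ⟨_, rfl⟩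
  have hq0 : 0 < q := by rw [hq]; positivity
  have hqd : q * 2 ^ (r₃ - s₃) = 1 := by
    rw [hq, ← Real.rpow_add (by norm_num)]; simp
  have h2d : 1 + (r₃ - s₃) / 2 ≤ (2 : ℝ) ^ (r₃ - s₃) := by
    rw [Real.rpow_def_of_pos (by norm_num)]
    have h1 := Real.add_one_le_exp (Real.log 2 * (r₃ - s₃))
    have h2 := Real.log_two_gt_d9
    nlinarith
  have hq1 : q < 1 := by nlinarith
  have hqi : (1 - q)⁻¹ ≤ 16 * (1 + 1 / (r₃ - s₃)) := by
    have h3 : q * (1 + (r₃ - s₃) / 2) ≤ 1 := by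
      exact (mul_le_mul_of_nonneg_left h2d hq0.le).trans hqd.le
    rw [inv_le_iff_one_le_mul₀ (by linarith)]
    have h4 : 0 < 1 / (r₃ - s₃) := by positivity
    have h5 : 1 / (r₃ - s₃) * (r₃ - s₃) = 1 := by field_simp
    have h6 : 1 / (r₃ - s₃) * (q * (1 + (r₃ - s₃) / 2)) ≤ 1 / (r₃ - s₃) * 1 :=
      mul_le_mul_of_nonneg_left h3 h4.le
    nlinarith
  obtain ⟨C, hC⟩ : ∃ C, C = H₃ * (L / ν) ^ s₃ * (L / 2) ^ (-r₃) := ⟨_, rfl⟩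
  have hC0 : 0 < C := by rw [hC]; positivity
  let E : ℕ → Set Ω := fun i =>
    {ω | ∃ j : ℕ, j ≤ ⌊(2 : ℝ) ^ i * (L / ν)⌋₊ ∧ 2 ^ i * (L / 2) ≤ φ j ω}
  have hE : ∀ i, μ (E i) ≤ ENNReal.ofReal (C * q ^ i) := by
    intro i
    rcases Nat.eq_zero_or_pos ⌊(2 : ℝ) ^ i * (L / ν)⌋₊ with h0 | h0
    · have : E i = ∅ := by
        ext ω
        simp only [E, Set.mem_setOf_eq, Set.mem_empty_iff_false, iff_false, h0]
        rintro ⟨j, hj, h⟩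
        obtain rfl : j = 0 := by omega
        rw [hφ0] at h
        have : 0 < (2 : ℝ) ^ i * (L / 2) := by positivity
        linarith
      rw [this]; simp
    · have h := hyp _ h0 (2 ^ i * (L / 2)) (by positivity)
      rw [← ENNReal.ofReal_toReal (measure_ne_top μ (E i))]
      apply ENNReal.ofReal_le_ofReal
      refine h.trans ?_
      have hf : ((⌊(2 : ℝ) ^ i * (L / ν)⌋₊ : ℕ) : ℝ) ^ s₃ ≤ ((2 : ℝ) ^ i * (L / ν)) ^ s₃ :=
        Real.rpow_le_rpow (by positivity) (Nat.floor_le (by positivity)) (by linarith)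
      calc _ ≤ H₃ * ((2 : ℝ) ^ i * (L / ν)) ^ s₃ * (2 ^ i * (L / 2)) ^ (-r₃) := by gcongr
        _ = C * q ^ i := by
          have e : q ^ i = ((2 : ℝ) ^ i) ^ s₃ * ((2 : ℝ) ^ i) ^ (-r₃) := by
            rw [← Real.rpow_add (by positivity), hq, ← Real.rpow_natCast, ← Real.rpow_natCast,
              ← Real.rpow_mul (by norm_num), ← Real.rpow_mul (by norm_num)]
            congr 1; ring
          rw [Real.mul_rpow (by positivity) (by positivity),
            Real.mul_rpow (by positivity) (by positivity), hC, e]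
          ring
  have hsub : {ω | (lam : EReal) ≤ ⨆ k : ℕ, ((φ k ω - ν * (k : ℝ) : ℝ) : EReal)} ⊆ ⋃ i, E i := by
    intro ω hω
    have hlt : (L : EReal) < ⨆ k : ℕ, ((φ k ω - ν * (k : ℝ) : ℝ) : EReal) :=
      lt_of_lt_of_le (EReal.coe_lt_coe_iff.2 (by linarith)) hω
    obtain ⟨k, hk⟩ := lt_iSup_iff.1 hlt
    rw [EReal.coe_lt_coe_iff] at hk
    have hx : 0 < L / ν := by positivity
    have hex : ∃ i : ℕ, (k : ℝ) ≤ 2 ^ i * (L / ν) := by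
      obtain ⟨n, hn⟩ := pow_unbounded_of_one_lt ((k : ℝ) / (L / ν)) (one_lt_two)
      exact ⟨n, ((div_lt_iff₀ hx).1 hn).le⟩
    classical
    have hs := Nat.find_spec hex
    have hm := fun m => Nat.find_min hex (m := m)
    refine Set.mem_iUnion.2 ⟨Nat.find hex, k, Nat.le_floor hs, ?_⟩
    have hνk : 0 ≤ ν * (k : ℝ) := by positivity
    rcases hn : Nat.find hex with _ | n
    · simp only [pow_zero]; linarith
    · have h1 := hm n (by omega)
      push Not at h1
      have h2 : ν * (2 ^ n * (L / ν)) ≤ ν * k := mul_le_mul_of_nonneg_left h1.le hν.le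
      have h3 : ν * (2 ^ n * (L / ν)) = 2 ^ n * L := by field_simp
      rw [pow_succ]
      linarith
  have hsum : Summable (fun i : ℕ => C * q ^ i) :=
    (summable_geometric_of_lt_one hq0.le hq1).mul_left C
  have hb : (μ {ω | (lam : EReal) ≤ ⨆ k : ℕ, ((φ k ω - ν * (k : ℝ) : ℝ) : EReal)}).toReal
      ≤ C * (1 - q)⁻¹ := by
    apply ENNReal.toReal_le_of_le_ofReal
    · have : 0 < 1 - q := by linarith
      positivity
    calc _ ≤ μ (⋃ i, E i) := measure_mono hsub
      _ ≤ ∑' i, μ (E i) := measure_iUnion_le _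
      _ ≤ ∑' i, ENNReal.ofReal (C * q ^ i) := ENNReal.tsum_le_tsum hE
      _ = ENNReal.ofReal (∑' i, C * q ^ i) :=
        (ENNReal.ofReal_tsum_of_nonneg (fun i => by positivity) hsum).symm
      _ = _ := by rw [tsum_mul_left, tsum_geometric_of_lt_one hq0.le hq1]
  have hCle : C ≤ H₃ * 4 ^ r₃ * ν ^ (-s₃) * lam ^ (-(r₃ - s₃)) := by
    have e1 : (L / ν) ^ s₃ = lam ^ s₃ * 2 ^ (-s₃) * ν ^ (-s₃) := by
      rw [hL, Real.div_rpow (by positivity) hν.le, Real.div_rpow hlam.le (by norm_num),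
        Real.rpow_neg (by norm_num), Real.rpow_neg hν.le]
      rfl
    have e2 : (L / 2) ^ (-r₃) = lam ^ (-r₃) * 4 ^ r₃ := by
      rw [hL, div_div, Real.div_rpow hlam.le (by norm_num), Real.rpow_neg (by norm_num : (0:ℝ) ≤ 2 * 2),
        div_inv_eq_mul]
      norm_num
    have e3 : lam ^ (-(r₃ - s₃)) = lam ^ s₃ * lam ^ (-r₃) := by
      rw [← Real.rpow_add hlam]; congr 1; ring
    have e4 : (2 : ℝ) ^ (-s₃) ≤ 1 := Real.rpow_le_one_of_one_le_of_nonpos (by norm_num) (by linarith)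
    rw [hC, e1, e2, e3]
    have : 0 ≤ H₃ * 4 ^ r₃ * ν ^ (-s₃) * (lam ^ s₃ * lam ^ (-r₃)) := by positivity
    nlinarith [mul_le_mul_of_nonneg_left e4 this]
  have hi0 : 0 ≤ (1 - q)⁻¹ := inv_nonneg.2 (by linarith)
  calc _ ≤ C * (1 - q)⁻¹ := hb
    _ ≤ (H₃ * 4 ^ r₃ * ν ^ (-s₃) * lam ^ (-(r₃ - s₃))) * (16 * (1 + 1 / (r₃ - s₃))) :=
      mul_le_mul hCle hqi hi0 (by positivity)
    _ = _ := by ring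
end
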